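/- Let p be an odd prime and let i, j be natural numbers with i + j < p - 1. Then p divides Σ_{k=0}^{p-1} C(k,i)·C(k,j). -/

import Mathlib

open Polynomial in
/-- Over a finite field with `q` elements, the values of a polynomial of degree `< q - 1`
sum to zero. -/
theorem FiniteField.sum_eval_eq_zero_of_natDegree_lt {K : Type*} [Field K] [Fintype K]
    (f : K[X]) (hf : f.natDegree < Fintype.card K - 1) : ∑ x : K, f.eval x = 0 := by
  simp_rw [eval_eq_sum_range]
  rw [Finset.sum_comm]
  refine Finset.sum_eq_zero fun m hm => ?_
  rw [← Finset.mul_sum, FiniteField.sum_pow_lt_card_sub_one K m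
    ((Finset.mem_range_succ_iff.mp hm).trans_lt hf), mul_zero]

theorem ZMod.sum_range_natCast {M : Type*} [AddCommMonoid M] (n : ℕ) [NeZero n]
    (f : ZMod n → M) : ∑ k ∈ Finset.range n, f k = ∑ x : ZMod n, f x :=
  Finset.sum_nbij' (fun k => (k : ZMod n)) ZMod.val (by simp)
    (fun x _ => Finset.mem_range.mpr x.val_lt)
    (fun _ hk => ZMod.val_cast_of_lt (Finset.mem_range.mp hk))
    (fun x _ => ZMod.natCast_zmod_val x) (fun _ _ => rfl)

theorem stmt_14 (p : ℕ) (hp : p.Prime) (hodd : Odd p)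
    (i j : ℕ) (h : i + j < p - 1) :
    p ∣ ∑ k ∈ Finset.range p, k.choose i * k.choose j := by
  have : Fact p.Prime := ⟨hp⟩
  have hdvd : p ∣ i.factorial * j.factorial *
      ∑ k ∈ Finset.range p, k.choose i * k.choose j := by
    rw [← ZMod.natCast_eq_zero_iff]
    calc ((i.factorial * j.factorial *
          ∑ k ∈ Finset.range p, k.choose i * k.choose j : ℕ) : ZMod p)
        = ∑ k ∈ Finset.range p,
            (descPochhammer (ZMod p) i * descPochhammer (ZMod p) j).eval (k : ZMod p) := by
          rw [Finset.mul_sum, Nat.cast_sum]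
          refine Finset.sum_congr rfl fun k _ => ?_
          rw [Polynomial.eval_mul, descPochhammer_eval_eq_descFactorial,
            descPochhammer_eval_eq_descFactorial, Nat.descFactorial_eq_factorial_mul_choose,
            Nat.descFactorial_eq_factorial_mul_choose]
          push_cast
          ring
      _ = ∑ x : ZMod p, (descPochhammer (ZMod p) i * descPochhammer (ZMod p) j).eval x :=
          ZMod.sum_range_natCast p fun x =>
            (descPochhammer (ZMod p) i * descPochhammer (ZMod p) j).eval x
      _ = 0 := by
          apply FiniteField.sum_eval_eq_zero_of_natDegree_lt
          rw [ZMod.card]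
          refine Polynomial.natDegree_mul_le.trans_lt ?_
          rwa [descPochhammer_natDegree, descPochhammer_natDegree]
  refine (hp.dvd_mul.mp hdvd).resolve_left fun hfac => ?_
  rcases hp.dvd_mul.mp hfac with hi | hj
  · have := hp.dvd_factorial.mp hi
    omega
  · have := hp.dvd_factorial.mp hj
    omega
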